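/- arXiv:1902.10817 — 3 statements merged into one kernel-verified Lean document; each statement's English description precedes it below -/
import Mathlib

section
/- Let (E, Σ, μ) be a measure space with μ a positive measure, let p > 1 and 1/p + 1/q = 1, and let α, β, f, g : E → ℝ be nonnegative measurable functions with α + β = 1 on E, such that α f g, β f g, α f^p, α g^q, β f^p, β g^q and f g are μ-integrable. Then ∫_E f g dμ ≤ (∫_E α f^p dμ)^{1/p} (∫_E α g^q dμ)^{1/q} + (∫_E β f^p dμ)^{1/p} (∫_E β g^q dμ)^{1/q}, and moreover, if in addition f^p and g^q are μ-integrable, (∫_E α f^p dμ)^{1/p} (∫_E α g^q dμ)^{1/q} + (∫_E β f^p dμ)^{1/p} (∫_E β g^q dμ)^{1/q} ≤ (∫_E f^p dμ)^{1/p} (∫_E g^q dμ)^{1/q}. -/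
open MeasureTheory

/-- Hölder's inequality for two nonnegative functions, with respect to a nonnegative weight `w`. -/
theorem integral_weight_mul_le_Lp_mul_Lq {E : Type*} [MeasurableSpace E] {μ : Measure E}
    {p q : ℝ} (hpq : p.HolderConjugate q) {w f g : E → ℝ}
    (hwm : Measurable w) (hfm : Measurable f) (hgm : Measurable g)
    (hw : ∀ x, 0 ≤ w x) (hf : ∀ x, 0 ≤ f x) (hg : ∀ x, 0 ≤ g x)
    (hwf : Integrable (fun x => w x * f x ^ p) μ) (hwg : Integrable (fun x => w x * g x ^ q) μ) :
    ∫ x, w x * (f x * g x) ∂μ ≤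
      (∫ x, w x * f x ^ p ∂μ) ^ (1 / p) * (∫ x, w x * g x ^ q ∂μ) ^ (1 / q) := by
  have weight_rpow {r : ℝ} (hr : 0 < r) {h : E → ℝ} (hh : ∀ x, 0 ≤ h x) (x : E) :
      (w x ^ (1 / r) * h x) ^ r = w x * h x ^ r := by
    rw [Real.mul_rpow (Real.rpow_nonneg (hw x) _) (hh x), ← Real.rpow_mul (hw x),
      one_div_mul_cancel hr.ne', Real.rpow_one]
  have memLp_weight {r : ℝ} (hr : 0 < r) {h : E → ℝ} (hhm : Measurable h) (hh : ∀ x, 0 ≤ h x)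
      (hwh : Integrable (fun x => w x * h x ^ r) μ) :
      MemLp (fun x => w x ^ (1 / r) * h x) (ENNReal.ofReal r) μ := by
    have hm : Measurable fun x => w x ^ (1 / r) * h x := (hwm.pow_const _).mul hhm
    rw [← integrable_norm_rpow_iff hm.aestronglyMeasurable (by simpa using hr)
      ENNReal.ofReal_ne_top, ENNReal.toReal_ofReal hr.le]
    refine hwh.congr (.of_forall fun x => ?_)
    simp only [Real.norm_of_nonneg (mul_nonneg (Real.rpow_nonneg (hw x) _) (hh x)),
      weight_rpow hr hh]
  have key := integral_mul_le_Lp_mul_Lq_of_nonneg (μ := μ) hpq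
    (.of_forall fun x => mul_nonneg (Real.rpow_nonneg (hw x) _) (hf x))
    (.of_forall fun x => mul_nonneg (Real.rpow_nonneg (hw x) _) (hg x))
    (memLp_weight hpq.pos hfm hf hwf) (memLp_weight hpq.symm.pos hgm hg hwg)
  simp only [weight_rpow hpq.pos hf, weight_rpow hpq.symm.pos hg] at key
  refine le_of_eq_of_le (integral_congr_ae (.of_forall fun x => ?_)) key
  have hsum : 1 / p + 1 / q = 1 := by simpa using hpq.inv_add_inv_eq_one
  have hsplit : w x ^ (1 / p) * w x ^ (1 / q) = w x := by
    rw [← Real.rpow_add' (hw x) (hsum.trans_ne one_ne_zero), hsum, Real.rpow_one]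
  change w x * (f x * g x) = w x ^ (1 / p) * f x * (w x ^ (1 / q) * g x)
  rw [mul_mul_mul_comm, hsplit]

/-- Hölder's inequality for two-term sums, with the `p`-th and `q`-th powers as variables. -/
theorem rpow_mul_rpow_add_le {p q : ℝ} (hpq : p.HolderConjugate q) {a b c d : ℝ}
    (ha : 0 ≤ a) (hb : 0 ≤ b) (hc : 0 ≤ c) (hd : 0 ≤ d) :
    a ^ (1 / p) * c ^ (1 / q) + b ^ (1 / p) * d ^ (1 / q) ≤
      (a + b) ^ (1 / p) * (c + d) ^ (1 / q) := by
  have rpow_cancel {r x : ℝ} (hr : r ≠ 0) (hx : 0 ≤ x) : |x ^ (1 / r)| ^ r = x := by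
    rw [abs_of_nonneg (Real.rpow_nonneg hx _), ← Real.rpow_mul hx, one_div_mul_cancel hr,
      Real.rpow_one]
  have key := Real.inner_le_Lp_mul_Lq Finset.univ ![a ^ (1 / p), b ^ (1 / p)]
    ![c ^ (1 / q), d ^ (1 / q)] hpq
  simpa only [Fin.sum_univ_two, Matrix.cons_val_zero, Matrix.cons_val_one,
    rpow_cancel hpq.ne_zero, rpow_cancel hpq.symm.ne_zero, ha, hb, hc, hd] using key

/-- Corollary 3.1: the case `w = 1` of the two-weight improvement of Hölder's
inequality, for the isotonic linear functional `A(f) = ∫ f dμ`. -/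
theorem improved_holder_functional_corollary {E : Type*} [MeasurableSpace E] (μ : Measure E)
    (p q : ℝ) (hp : 1 < p) (hpq : 1 / p + 1 / q = 1)
    (α β f g : E → ℝ)
    (hαm : Measurable α) (hβm : Measurable β)
    (hfm : Measurable f) (hgm : Measurable g)
    (hα : ∀ x, 0 ≤ α x) (hβ : ∀ x, 0 ≤ β x)
    (hf : ∀ x, 0 ≤ f x) (hg : ∀ x, 0 ≤ g x)
    (hαβ : ∀ x, α x + β x = 1)
    (h1 : Integrable (fun x => α x * (f x * g x)) μ)
    (h2 : Integrable (fun x => β x * (f x * g x)) μ)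
    (h3 : Integrable (fun x => α x * f x ^ p) μ)
    (h4 : Integrable (fun x => α x * g x ^ q) μ)
    (h5 : Integrable (fun x => β x * f x ^ p) μ)
    (h6 : Integrable (fun x => β x * g x ^ q) μ)
    (h7 : Integrable (fun x => f x * g x) μ) :
    (∫ x, f x * g x ∂μ ≤
      (∫ x, α x * f x ^ p ∂μ) ^ (1 / p) * (∫ x, α x * g x ^ q ∂μ) ^ (1 / q) +
        (∫ x, β x * f x ^ p ∂μ) ^ (1 / p) * (∫ x, β x * g x ^ q ∂μ) ^ (1 / q)) ∧
    (Integrable (fun x => f x ^ p) μ → Integrable (fun x => g x ^ q) μ →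
      (∫ x, α x * f x ^ p ∂μ) ^ (1 / p) * (∫ x, α x * g x ^ q ∂μ) ^ (1 / q) +
          (∫ x, β x * f x ^ p ∂μ) ^ (1 / p) * (∫ x, β x * g x ^ q ∂μ) ^ (1 / q) ≤
        (∫ x, f x ^ p ∂μ) ^ (1 / p) * (∫ x, g x ^ q ∂μ) ^ (1 / q)) := by
  have hconj : p.HolderConjugate q := Real.holderConjugate_iff.mpr ⟨hp, by simpa using hpq⟩
  have integral_split {h : E → ℝ} (hαh : Integrable (fun x => α x * h x) μ)
      (hβh : Integrable (fun x => β x * h x) μ) :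
      ∫ x, h x ∂μ = ∫ x, α x * h x ∂μ + ∫ x, β x * h x ∂μ := by
    rw [← integral_add hαh hβh]
    simp only [← add_mul, hαβ, one_mul]
  refine ⟨?_, fun _ _ => ?_⟩
  · rw [integral_split h1 h2]
    exact add_le_add
      (integral_weight_mul_le_Lp_mul_Lq hconj hαm hfm hgm hα hf hg h3 h4)
      (integral_weight_mul_le_Lp_mul_Lq hconj hβm hfm hgm hβ hf hg h5 h6)
  · rw [integral_split h3 h5, integral_split h4 h6]
    exact rpow_mul_rpow_add_le hconj
      (integral_nonneg fun x => mul_nonneg (hα x) (Real.rpow_nonneg (hf x) p))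
      (integral_nonneg fun x => mul_nonneg (hβ x) (Real.rpow_nonneg (hf x) p))
      (integral_nonneg fun x => mul_nonneg (hα x) (Real.rpow_nonneg (hg x) q))
      (integral_nonneg fun x => mul_nonneg (hβ x) (Real.rpow_nonneg (hg x) q))
end

section
/- Let (E, Σ, μ) be a measure space with μ a positive measure, let p > 1 and 1/p + 1/q = 1, let m be a positive natural number, and let α_1, ..., α_m, w, f, g : E → ℝ be nonnegative measurable functions with ∑_{i=1}^m α_i = 1 on E, such that for each i the functions α_i w f g, α_i w f^p, α_i w g^q and also w f g are μ-integrable. Then ∫_E w f g dμ ≤ ∑_{i=1}^m (∫_E α_i w f^p dμ)^{1/p} (∫_E α_i w g^q dμ)^{1/q}. -/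
open MeasureTheory

/-- The `r`-th power of `v ^ (1 / r) * f` is `v * f ^ r` on nonnegative reals. -/
lemma rpow_one_div_mul_rpow {r v f : ℝ} (hr : r ≠ 0) (hv : 0 ≤ v) (hf : 0 ≤ f) :
    (v ^ (1 / r) * f) ^ r = v * f ^ r := by
  rw [Real.mul_rpow (Real.rpow_nonneg hv _) hf, ← Real.rpow_mul hv, one_div_mul_cancel hr,
    Real.rpow_one]

lemma memLp_rpow_one_div_mul {E : Type*} [MeasurableSpace E] {μ : Measure E} {r : ℝ}
    (hr : 0 < r) {v f : E → ℝ} (hvm : Measurable v) (hfm : Measurable f)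
    (hv : ∀ x, 0 ≤ v x) (hf : ∀ x, 0 ≤ f x) (hvf : Integrable (fun x => v x * f x ^ r) μ) :
    MemLp (fun x => v x ^ (1 / r) * f x) (ENNReal.ofReal r) μ := by
  have hmeas : Measurable fun x => v x ^ (1 / r) * f x := (hvm.pow_const _).mul hfm
  rw [← integrable_norm_rpow_iff hmeas.aestronglyMeasurable (by simpa using hr)
    ENNReal.ofReal_ne_top, ENNReal.toReal_ofReal hr.le]
  refine hvf.congr (Filter.Eventually.of_forall fun x => ?_)
  simp only
  rw [Real.norm_of_nonneg (mul_nonneg (Real.rpow_nonneg (hv x) _) (hf x)),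
    rpow_one_div_mul_rpow hr.ne' (hv x) (hf x)]

/-- Hölder's inequality for nonnegative functions with a nonnegative weight `v`. -/
lemma integral_weight_mul_mul_le_Lp_mul_Lq {E : Type*} [MeasurableSpace E] {μ : Measure E}
    {p q : ℝ} (hpq : p.HolderConjugate q) {v f g : E → ℝ} (hvm : Measurable v)
    (hfm : Measurable f) (hgm : Measurable g) (hv : ∀ x, 0 ≤ v x) (hf : ∀ x, 0 ≤ f x)
    (hg : ∀ x, 0 ≤ g x) (hvf : Integrable (fun x => v x * f x ^ p) μ)
    (hvg : Integrable (fun x => v x * g x ^ q) μ) :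
    ∫ x, v x * f x * g x ∂μ ≤
      (∫ x, v x * f x ^ p ∂μ) ^ (1 / p) * (∫ x, v x * g x ^ q ∂μ) ^ (1 / q) := by
  have key := integral_mul_le_Lp_mul_Lq_of_nonneg hpq
    (Filter.Eventually.of_forall fun x => mul_nonneg (Real.rpow_nonneg (hv x) _) (hf x))
    (Filter.Eventually.of_forall fun x => mul_nonneg (Real.rpow_nonneg (hv x) _) (hg x))
    (memLp_rpow_one_div_mul hpq.pos hvm hfm hv hf hvf)
    (memLp_rpow_one_div_mul hpq.symm.pos hvm hgm hv hg hvg)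
  have hprod : ∀ x, v x ^ (1 / p) * f x * (v x ^ (1 / q) * g x) = v x * f x * g x := by
    intro x
    have hsplit : v x ^ (1 / p) * v x ^ (1 / q) = v x := by
      rw [← Real.rpow_add_of_nonneg (hv x) hpq.one_div_nonneg hpq.symm.one_div_nonneg,
        one_div, one_div, hpq.inv_add_inv_eq_one, Real.rpow_one]
    calc _ = v x ^ (1 / p) * v x ^ (1 / q) * f x * g x := by ring
      _ = _ := by rw [hsplit]
  simpa only [hprod, rpow_one_div_mul_rpow hpq.ne_zero (hv _) (hf _),
    rpow_one_div_mul_rpow hpq.symm.ne_zero (hv _) (hg _)] using key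

/-- Theorem 3.2(i): the `m`-weight improvement of Hölder's inequality for the
isotonic linear functional `A(f) = ∫ f dμ`. -/
theorem improved_holder_functional_m_i {E : Type*} [MeasurableSpace E] (μ : Measure E)
    (p q : ℝ) (hp : 1 < p) (hpq : 1 / p + 1 / q = 1)
    (m : ℕ) (hm : 0 < m) (α : Fin m → E → ℝ) (w f g : E → ℝ)
    (hαm : ∀ i, Measurable (α i)) (hwm : Measurable w)
    (hfm : Measurable f) (hgm : Measurable g)
    (hα : ∀ i, ∀ x, 0 ≤ α i x) (hw : ∀ x, 0 ≤ w x)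
    (hf : ∀ x, 0 ≤ f x) (hg : ∀ x, 0 ≤ g x)
    (hαsum : ∀ x, ∑ i, α i x = 1)
    (h1 : ∀ i, Integrable (fun x => α i x * (w x * f x * g x)) μ)
    (h2 : ∀ i, Integrable (fun x => α i x * (w x * f x ^ p)) μ)
    (h3 : ∀ i, Integrable (fun x => α i x * (w x * g x ^ q)) μ)
    (h4 : Integrable (fun x => w x * f x * g x) μ) :
    ∫ x, w x * f x * g x ∂μ ≤
      ∑ i, (∫ x, α i x * (w x * f x ^ p) ∂μ) ^ (1 / p) *
        (∫ x, α i x * (w x * g x ^ q) ∂μ) ^ (1 / q) := by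
  have hconj : p.HolderConjugate q :=
    Real.holderConjugate_iff.2 ⟨hp, by simpa only [one_div] using hpq⟩
  have hsum : ∫ x, w x * f x * g x ∂μ = ∑ i, ∫ x, α i x * (w x * f x * g x) ∂μ := by
    rw [← integral_finsetSum _ fun i _ => h1 i]
    simp only [← Finset.sum_mul, hαsum, one_mul]
  rw [hsum]
  refine Finset.sum_le_sum fun i _ => ?_
  simpa only [mul_assoc] using integral_weight_mul_mul_le_Lp_mul_Lq (v := fun x => α i x * w x)
    hconj ((hαm i).mul hwm) hfm hgm (fun x => mul_nonneg (hα i x) (hw x)) hf hg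
    (by simpa only [mul_assoc] using h2 i) (by simpa only [mul_assoc] using h3 i)
end

section
/- Let (a_{k,l}) and (b_{k,l}), 1 ≤ k ≤ n, 1 ≤ l ≤ m, be two doubly indexed families of positive real numbers, and let p, q > 1 with 1/p + 1/q = 1. Define α_1(k,l) = kl/(nm), α_2(k,l) = (n-k)l/(nm), α_3(k,l) = (n-k)(m-l)/(nm), α_4(k,l) = k(m-l)/(nm). Then ∑_{k=1}^n ∑_{l=1}^m a_{k,l} b_{k,l} ≤ ∑_{i=1}^4 (∑_{k=1}^n ∑_{l=1}^m α_i(k,l) a_{k,l}^p)^{1/p} (∑_{k=1}^n ∑_{l=1}^m α_i(k,l) b_{k,l}^q)^{1/q}. -/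
/-- Weighted Hölder inequality for finite sums of nonnegative real numbers. -/
theorem sum_weight_mul_le_Lp_mul_Lq {ι : Type*} (s : Finset ι) {p q : ℝ}
    (hpq : p.HolderConjugate q) {w f g : ι → ℝ} (hw : ∀ i ∈ s, 0 ≤ w i)
    (hf : ∀ i ∈ s, 0 ≤ f i) (hg : ∀ i ∈ s, 0 ≤ g i) :
    ∑ i ∈ s, w i * (f i * g i) ≤
      (∑ i ∈ s, w i * f i ^ p) ^ (1 / p) * (∑ i ∈ s, w i * g i ^ q) ^ (1 / q) := by
  have rpow_weight : ∀ {r : ℝ}, r ≠ 0 → ∀ {h : ι → ℝ}, (∀ i ∈ s, 0 ≤ h i) →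
      ∑ i ∈ s, (w i ^ r⁻¹ * h i) ^ r = ∑ i ∈ s, w i * h i ^ r := fun hr _ hh ↦
    Finset.sum_congr rfl fun i hi ↦ by
      rw [Real.mul_rpow (Real.rpow_nonneg (hw i hi) _) (hh i hi),
        Real.rpow_inv_rpow (hw i hi) hr]
  have holder := Real.inner_le_Lp_mul_Lq_of_nonneg s hpq
    (f := fun i ↦ w i ^ p⁻¹ * f i) (g := fun i ↦ w i ^ q⁻¹ * g i)
    (fun i hi ↦ mul_nonneg (Real.rpow_nonneg (hw i hi) _) (hf i hi))
    (fun i hi ↦ mul_nonneg (Real.rpow_nonneg (hw i hi) _) (hg i hi))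
  rw [rpow_weight hpq.ne_zero hf, rpow_weight hpq.symm.ne_zero hg] at holder
  refine le_of_eq_of_le (Finset.sum_congr rfl fun i hi ↦ ?_) holder
  have split_weight : w i ^ p⁻¹ * w i ^ q⁻¹ = w i := by
    rw [← Real.rpow_add_of_nonneg (hw i hi) hpq.inv_nonneg hpq.symm.inv_nonneg,
      hpq.inv_add_inv_eq_one, Real.rpow_one]
  rw [mul_mul_mul_comm, split_weight]

/-- Weighted Hölder inequality for double sums of nonnegative real numbers. -/
theorem sum_sum_weight_mul_le_Lp_mul_Lq {ι κ : Type*} (s : Finset ι) (t : Finset κ) {p q : ℝ}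
    (hpq : p.HolderConjugate q) {w f g : ι → κ → ℝ} (hw : ∀ i ∈ s, ∀ j ∈ t, 0 ≤ w i j)
    (hf : ∀ i ∈ s, ∀ j ∈ t, 0 ≤ f i j) (hg : ∀ i ∈ s, ∀ j ∈ t, 0 ≤ g i j) :
    ∑ i ∈ s, ∑ j ∈ t, w i j * (f i j * g i j) ≤
      (∑ i ∈ s, ∑ j ∈ t, w i j * f i j ^ p) ^ (1 / p) *
        (∑ i ∈ s, ∑ j ∈ t, w i j * g i j ^ q) ^ (1 / q) := by
  simp only [← Finset.sum_product']
  have on_product : ∀ {h : ι → κ → ℝ}, (∀ i ∈ s, ∀ j ∈ t, 0 ≤ h i j) →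
      ∀ x ∈ s ×ˢ t, 0 ≤ h x.1 x.2 := fun hh x hx ↦
    hh x.1 (Finset.mem_product.mp hx).1 x.2 (Finset.mem_product.mp hx).2
  exact sum_weight_mul_le_Lp_mul_Lq (s ×ˢ t) hpq (w := fun x ↦ w x.1 x.2)
    (f := fun x ↦ f x.1 x.2) (g := fun x ↦ g x.1 x.2)
    (on_product hw) (on_product hf) (on_product hg)

/-- Improvement of Hölder's inequality for double sums. -/
theorem improved_holder_double_sum (n m : ℕ) (hn : 0 < n) (hm : 0 < m)
    (p q : ℝ) (hp : 1 < p) (hq : 1 < q) (hpq : 1 / p + 1 / q = 1)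
    (a b : ℕ → ℕ → ℝ)
    (ha : ∀ k ∈ Finset.Icc 1 n, ∀ l ∈ Finset.Icc 1 m, 0 < a k l)
    (hb : ∀ k ∈ Finset.Icc 1 n, ∀ l ∈ Finset.Icc 1 m, 0 < b k l) :
    ∑ k ∈ Finset.Icc 1 n, ∑ l ∈ Finset.Icc 1 m, a k l * b k l ≤
      (∑ k ∈ Finset.Icc 1 n, ∑ l ∈ Finset.Icc 1 m,
          ((k : ℝ) * (l : ℝ) / ((n : ℝ) * (m : ℝ))) * a k l ^ p) ^ (1 / p) *
        (∑ k ∈ Finset.Icc 1 n, ∑ l ∈ Finset.Icc 1 m,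
          ((k : ℝ) * (l : ℝ) / ((n : ℝ) * (m : ℝ))) * b k l ^ q) ^ (1 / q) +
      (∑ k ∈ Finset.Icc 1 n, ∑ l ∈ Finset.Icc 1 m,
          (((n : ℝ) - (k : ℝ)) * (l : ℝ) / ((n : ℝ) * (m : ℝ))) * a k l ^ p) ^ (1 / p) *
        (∑ k ∈ Finset.Icc 1 n, ∑ l ∈ Finset.Icc 1 m,
          (((n : ℝ) - (k : ℝ)) * (l : ℝ) / ((n : ℝ) * (m : ℝ))) * b k l ^ q) ^ (1 / q) +
      (∑ k ∈ Finset.Icc 1 n, ∑ l ∈ Finset.Icc 1 m,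
          (((n : ℝ) - (k : ℝ)) * ((m : ℝ) - (l : ℝ)) / ((n : ℝ) * (m : ℝ))) * a k l ^ p) ^ (1 / p) *
        (∑ k ∈ Finset.Icc 1 n, ∑ l ∈ Finset.Icc 1 m,
          (((n : ℝ) - (k : ℝ)) * ((m : ℝ) - (l : ℝ)) / ((n : ℝ) * (m : ℝ))) * b k l ^ q) ^ (1 / q) +
      (∑ k ∈ Finset.Icc 1 n, ∑ l ∈ Finset.Icc 1 m,
          ((k : ℝ) * ((m : ℝ) - (l : ℝ)) / ((n : ℝ) * (m : ℝ))) * a k l ^ p) ^ (1 / p) *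
        (∑ k ∈ Finset.Icc 1 n, ∑ l ∈ Finset.Icc 1 m,
          ((k : ℝ) * ((m : ℝ) - (l : ℝ)) / ((n : ℝ) * (m : ℝ))) * b k l ^ q) ^ (1 / q) := by
  have conj : p.HolderConjugate q :=
    Real.holderConjugate_iff.mpr ⟨hp, by simpa only [one_div] using hpq⟩
  have sub_nonneg_of_mem : ∀ {N i : ℕ}, i ∈ Finset.Icc 1 N → (0 : ℝ) ≤ (N : ℝ) - (i : ℝ) :=
    fun hi ↦ sub_nonneg.mpr (Nat.cast_le.mpr (Finset.mem_Icc.mp hi).2)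
  have holder : ∀ {w : ℕ → ℕ → ℝ},
      (∀ k ∈ Finset.Icc 1 n, ∀ l ∈ Finset.Icc 1 m, 0 ≤ w k l) → _ := fun {w} hw ↦
    sum_sum_weight_mul_le_Lp_mul_Lq (Finset.Icc 1 n) (Finset.Icc 1 m) conj (w := w) hw
      (fun k hk l hl ↦ (ha k hk l hl).le) (fun k hk l hl ↦ (hb k hk l hl).le)
  refine le_of_eq_of_le ?_ (add_le_add (add_le_add (add_le_add
    (holder fun k _ l _ ↦ by positivity)
    (holder fun k hk l _ ↦ ?_)) (holder fun k hk l hl ↦ ?_)) (holder fun k _ l hl ↦ ?_))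
  · simp only [← Finset.sum_add_distrib]
    refine Finset.sum_congr rfl fun k _ ↦ Finset.sum_congr rfl fun l _ ↦ ?_
    field_simp
    ring
  · have := sub_nonneg_of_mem hk
    positivity
  · have := sub_nonneg_of_mem hk
    have := sub_nonneg_of_mem hl
    positivity
  · have := sub_nonneg_of_mem hl
    positivity
end
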